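/- arXiv:2209.04315 — 2 statements merged into one kernel-verified Lean document; each statement's English description precedes it below -/
import Mathlib

section
/- Let K be a positive integer, r_1,…,r_K, θ_1,…,θ_K real numbers, z_1,…,z_K rationally independent real numbers, and define x(τ) = Σ_{k=1}^K r_k cos(θ_k + τ z_k). Then for every λ ∈ ℝ and every h > 0, the empirical characteristic function of the lag process converges: lim_{T→∞} (1/T) ∫_0^T e^{i λ (x(τ+h) − x(τ))} dτ = Π_{k=1}^K J₀(2 λ r_k sin(h z_k / 2)). -/
open MeasureTheory Filter

/-- Bessel function of the first kind of order 0: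
`J₀(s) = (1/(2π)) ∫_{−π}^{π} e^{i s cos u} du`. -/
noncomputable def besselJ0 (s : ℝ) : ℂ :=
  ((2 * Real.pi : ℝ) : ℂ)⁻¹ *
    ∫ u in (-Real.pi)..Real.pi, Complex.exp (Complex.I * ((s * Real.cos u : ℝ) : ℂ))

/-- `z_1,…,z_K` are rationally independent. -/
def RationallyIndependent {K : ℕ} (z : Fin K → ℝ) : Prop :=
  ∀ m : Fin K → ℤ, (∑ k, (m k : ℝ) * z k) = 0 → ∀ k, m k = 0

/-- The normalised Haar measure on the torus. -/
noncomputable def torusMeasure (K : ℕ) : Measure (UnitAddTorus (Fin K)) :=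
  Measure.pi (fun _ => AddCircle.haarAddCircle)

instance torusMeasure_isProb (K : ℕ) : IsProbabilityMeasure (torusMeasure K) := by
  unfold torusMeasure; infer_instance

/-- The linear flow on the torus. -/
noncomputable def torusPath {K : ℕ} (p z : Fin K → ℝ) (t : ℝ) : UnitAddTorus (Fin K) :=
  fun k => (((p k + t * z k) / (2 * Real.pi) : ℝ) : UnitAddCircle)

lemma continuous_torusPath {K : ℕ} (p z : Fin K → ℝ) : Continuous (torusPath p z) := by
  unfold torusPath
  refine continuous_pi fun k => ?_
  exact (AddCircle.continuous_mk' 1).comp (by fun_prop)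

lemma integral_fourier_haar (n : ℤ) :
    ∫ t : UnitAddCircle, fourier n t ∂AddCircle.haarAddCircle = if n = 0 then 1 else 0 := by
  have h := congrFun (fourierCoeff_fourier (T := 1) n) 0
  simp only [fourierCoeff, neg_zero, fourier_zero, one_smul] at h
  rw [h, Pi.single_apply]
  simp [eq_comm]

lemma mFourier_torusPath {K : ℕ} (p z : Fin K → ℝ) (n : Fin K → ℤ) (t : ℝ) :
    UnitAddTorus.mFourier n (torusPath p z t) =
      Complex.exp (Complex.I * ((∑ k, (n k : ℝ) * p k : ℝ) : ℂ)) *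
      Complex.exp ((Complex.I * ((∑ k, (n k : ℝ) * z k : ℝ) : ℂ)) * t) := by
  simp only [UnitAddTorus.mFourier, ContinuousMap.coe_mk, torusPath]
  simp only [fourier_coe_apply]
  rw [← Complex.exp_sum, ← Complex.exp_add]
  congr 1
  push_cast
  rw [Finset.mul_sum, Finset.mul_sum, Finset.sum_mul, ← Finset.sum_add_distrib]
  refine Finset.sum_congr rfl fun k _ => ?_
  have : (Real.pi : ℂ) ≠ 0 := by exact_mod_cast Real.pi_ne_zero
  field_simp

lemma weyl_monomial {K : ℕ} (p z : Fin K → ℝ) (hz : RationallyIndependent z) (n : Fin K → ℤ) :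
    Tendsto (fun T : ℝ => ((T : ℂ))⁻¹ *
      ∫ t in (0 : ℝ)..T, UnitAddTorus.mFourier n (torusPath p z t)) atTop
      (nhds (∫ y, UnitAddTorus.mFourier n y ∂(torusMeasure K))) := by
  by_cases hn : n = 0
  · subst hn
    simp only [UnitAddTorus.mFourier_zero, ContinuousMap.one_apply]
    refine tendsto_const_nhds.congr' ?_
    filter_upwards [eventually_gt_atTop 0] with T hT
    have : (T : ℂ) ≠ 0 := by exact_mod_cast hT.ne'
    simp [this]
  · have hB : (∑ k, (n k : ℝ) * z k) ≠ 0 := fun h => hn (funext (hz n h))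
    have hint : ∫ y, UnitAddTorus.mFourier n y ∂(torusMeasure K) = 0 := by
      simp only [UnitAddTorus.mFourier, ContinuousMap.coe_mk, torusMeasure]
      rw [integral_fintype_prod_eq_prod (fun i => (fourier (n i) : UnitAddCircle → ℂ))]
      obtain ⟨k, hk⟩ := Function.ne_iff.mp hn
      refine Finset.prod_eq_zero (Finset.mem_univ k) ?_
      rw [integral_fourier_haar, if_neg (by simpa using hk)]
    rw [hint]
    set B := ∑ k, (n k : ℝ) * z k with hBdef
    have hc : Complex.I * (B : ℂ) ≠ 0 :=
      mul_ne_zero Complex.I_ne_zero (by exact_mod_cast hB)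
    simp only [mFourier_torusPath, ← hBdef]
    simp only [intervalIntegral.integral_const_mul, integral_exp_mul_complex hc]
    have hnorm : ∀ a : ℝ, ‖Complex.exp (Complex.I * (a : ℂ))‖ = 1 := by
      intro a; rw [mul_comm]; exact Complex.norm_exp_ofReal_mul_I a
    have h0 : Tendsto (fun T : ℝ => T⁻¹ * (2 / |B|)) atTop (nhds 0) := by
      simpa using tendsto_inv_atTop_zero.mul_const (2 / |B|)
    refine squeeze_zero_norm' ?_ h0
    filter_upwards [eventually_gt_atTop 0] with T hT
    rw [norm_mul, norm_mul, hnorm, norm_inv, Complex.norm_real, Real.norm_of_nonneg hT.le, one_mul,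
      norm_div, norm_mul, Complex.norm_I, one_mul, Complex.norm_real, Real.norm_eq_abs]
    gcongr
    refine (norm_sub_le _ _).trans ?_
    rw [mul_assoc, mul_assoc, ← Complex.ofReal_mul, ← Complex.ofReal_mul, hnorm, hnorm]
    norm_num

lemma weyl_span {K : ℕ} (p z : Fin K → ℝ) (hz : RationallyIndependent z)
    (F : C(UnitAddTorus (Fin K), ℂ))
    (hF : F ∈ Submodule.span ℂ (Set.range (UnitAddTorus.mFourier (d := Fin K)))) :
    Tendsto (fun T : ℝ => ((T : ℂ))⁻¹ * ∫ t in (0 : ℝ)..T, F (torusPath p z t)) atTop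
      (nhds (∫ y, F y ∂(torusMeasure K))) := by
  have hI : ∀ G : C(UnitAddTorus (Fin K), ℂ), Integrable G (torusMeasure K) := fun G =>
    G.continuous.integrable_of_hasCompactSupport (HasCompactSupport.of_compactSpace _)
  have hJ : ∀ (G : C(UnitAddTorus (Fin K), ℂ)) (T : ℝ),
      IntervalIntegrable (fun t => G (torusPath p z t)) volume 0 T := fun G T =>
    (G.continuous.comp (continuous_torusPath p z)).intervalIntegrable _ _
  induction hF using Submodule.span_induction with
  | mem F h =>
    obtain ⟨n, rfl⟩ := h
    exact weyl_monomial p z hz n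
  | zero => simp
  | add F G _ _ h1 h2 =>
    simp only [ContinuousMap.add_apply]
    rw [integral_add (hI F) (hI G)]
    refine (h1.add h2).congr fun T => ?_
    rw [intervalIntegral.integral_add (hJ F T) (hJ G T)]
    ring
  | smul c F _ h =>
    simp only [ContinuousMap.smul_apply, smul_eq_mul]
    rw [integral_const_mul]
    refine (h.const_mul c).congr fun T => ?_
    rw [intervalIntegral.integral_const_mul]
    ring

lemma weyl_continuous {K : ℕ} (p z : Fin K → ℝ) (hz : RationallyIndependent z)
    (F : C(UnitAddTorus (Fin K), ℂ)) :
    Tendsto (fun T : ℝ => ((T : ℂ))⁻¹ * ∫ t in (0 : ℝ)..T, F (torusPath p z t)) atTop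
      (nhds (∫ y, F y ∂(torusMeasure K))) := by
  have hI : ∀ G : C(UnitAddTorus (Fin K), ℂ), Integrable G (torusMeasure K) := fun G =>
    G.continuous.integrable_of_hasCompactSupport (HasCompactSupport.of_compactSpace _)
  have hJ : ∀ (G : C(UnitAddTorus (Fin K), ℂ)) (T : ℝ),
      IntervalIntegrable (fun t => G (torusPath p z t)) volume 0 T := fun G T =>
    (G.continuous.comp (continuous_torusPath p z)).intervalIntegrable _ _
  rw [Metric.tendsto_nhds]
  intro ε hε
  have hmem : F ∈ (Submodule.span ℂ
      (Set.range (UnitAddTorus.mFourier (d := Fin K)))).topologicalClosure := by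
    rw [UnitAddTorus.span_mFourier_closure_eq_top]; trivial
  have hmem' : F ∈ closure ((Submodule.span ℂ
      (Set.range (UnitAddTorus.mFourier (d := Fin K))) :
        Submodule ℂ C(UnitAddTorus (Fin K), ℂ)) : Set C(UnitAddTorus (Fin K), ℂ)) := hmem
  obtain ⟨G, hG, hFG⟩ := Metric.mem_closure_iff.mp hmem' (ε / 3) (by positivity)
  rw [dist_eq_norm] at hFG
  have hpt : ∀ y, ‖F y - G y‖ ≤ ε / 3 := fun y =>
    ((F - G).norm_coe_le_norm y).trans hFG.le
  filter_upwards [(Metric.tendsto_nhds.mp (weyl_span p z hz G hG)) (ε / 3) (by positivity),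
    eventually_gt_atTop 0] with T hT hT0
  rw [dist_eq_norm] at hT ⊢
  have h1 : ‖((T : ℂ))⁻¹ * (∫ t in (0 : ℝ)..T, F (torusPath p z t)) -
      ((T : ℂ))⁻¹ * ∫ t in (0 : ℝ)..T, G (torusPath p z t)‖ ≤ ε / 3 := by
    rw [← mul_sub, ← intervalIntegral.integral_sub (hJ F T) (hJ G T), norm_mul, norm_inv,
      Complex.norm_real, Real.norm_of_nonneg hT0.le]
    have := intervalIntegral.norm_integral_le_of_norm_le_const (a := 0) (b := T) (C := ε / 3)
      (f := fun t => F (torusPath p z t) - G (torusPath p z t)) (fun t _ => hpt _)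
    rw [sub_zero, abs_of_pos hT0] at this
    rw [inv_mul_le_iff₀ hT0]
    linarith
  have h2 : ‖(∫ y, G y ∂(torusMeasure K)) - ∫ y, F y ∂(torusMeasure K)‖ ≤ ε / 3 := by
    rw [norm_sub_rev, ← integral_sub (hI F) (hI G)]
    have := norm_integral_le_of_norm_le_const (μ := torusMeasure K) (C := ε / 3)
      (f := fun y => F y - G y) (Eventually.of_forall hpt)
    simpa using this
  set A := ((T : ℂ))⁻¹ * (∫ t in (0 : ℝ)..T, F (torusPath p z t))
  set B := ((T : ℂ))⁻¹ * (∫ t in (0 : ℝ)..T, G (torusPath p z t))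
  set C := ∫ y, G y ∂(torusMeasure K)
  set D := ∫ y, F y ∂(torusMeasure K)
  have h3 : A - D = (A - B) + (B - C) + (C - D) := by ring
  rw [h3]
  have := norm_add₃_le (a := A - B) (b := B - C) (c := C - D)
  linarith

/-- The function `exp (i s cos (2 π y))` on the circle. -/
noncomputable def besselKernel (s : ℝ) : C(UnitAddCircle, ℂ) where
  toFun y := Complex.exp (Complex.I * ((s * (fourier 1 y).re : ℝ) : ℂ))
  continuous_toFun := by fun_prop

lemma besselKernel_coe (s u : ℝ) :
    besselKernel s ((u / (2 * Real.pi) : ℝ) : UnitAddCircle) =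
      Complex.exp (Complex.I * ((s * Real.cos u : ℝ) : ℂ)) := by
  simp only [besselKernel, ContinuousMap.coe_mk, fourier_coe_apply]
  have : (2 * Real.pi * Complex.I * ((1 : ℤ) : ℂ) * ((u / (2 * Real.pi) : ℝ) : ℂ) / ((1 : ℝ) : ℂ))
      = (u : ℂ) * Complex.I := by
    have : (Real.pi : ℂ) ≠ 0 := by exact_mod_cast Real.pi_ne_zero
    push_cast
    field_simp
  rw [this, Complex.exp_ofReal_mul_I_re]

lemma integral_besselKernel (s : ℝ) :
    ∫ y, besselKernel s y ∂AddCircle.haarAddCircle = besselJ0 s := by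
  have h := fourierCoeff_eq_intervalIntegral (T := 1) (besselKernel s) 0 (-(1 / 2))
  simp only [fourierCoeff, neg_zero, fourier_zero, one_smul] at h
  rw [h]
  have h2 := intervalIntegral.integral_comp_div (a := -Real.pi) (b := Real.pi)
    (fun v : ℝ => besselKernel s (v : UnitAddCircle)) (c := 2 * Real.pi) (by positivity)
  simp only [besselKernel_coe] at h2
  unfold besselJ0
  rw [h2]
  have e1 : -Real.pi / (2 * Real.pi) = -(1 / 2) := by
    have := Real.pi_ne_zero
    field_simp
  have e2 : Real.pi / (2 * Real.pi) = -(1 / 2) + 1 := by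
    have := Real.pi_ne_zero
    field_simp
    norm_num
  rw [e1, e2, Complex.real_smul, Complex.real_smul, ← mul_assoc, inv_mul_cancel₀]
  · simp
  · exact_mod_cast (by positivity : (2 * Real.pi) ≠ 0)

/-- The empirical characteristic function of the lag process of a path
`x(τ) = Σ_k r_k cos(θ_k + τ z_k)` with rationally independent frequencies converges to
`Π_k J₀(2 λ r_k sin(h z_k / 2))`. -/
theorem empirical_charFun_lag_tendsto_prod_besselJ0
    (K : ℕ) (hK : 0 < K) (r θ z : Fin K → ℝ) (hz : RationallyIndependent z)
    (x : ℝ → ℝ) (hx : ∀ τ, x τ = ∑ k, r k * Real.cos (θ k + τ * z k))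
    (lam : ℝ) (h : ℝ) (hh : 0 < h) :
    Tendsto
      (fun T : ℝ => ((T : ℂ))⁻¹ *
        ∫ τ in (0 : ℝ)..T,
          Complex.exp (Complex.I * ((lam * (x (τ + h) - x τ) : ℝ) : ℂ)))
      atTop (nhds (∏ k, besselJ0 (2 * lam * r k * Real.sin (h * z k / 2)))) := by
  let s : Fin K → ℝ := fun k => 2 * lam * r k * Real.sin (h * z k / 2)
  let p : Fin K → ℝ := fun k => θ k + h * z k / 2 + Real.pi / 2
  let F : C(UnitAddTorus (Fin K), ℂ) :=
    ⟨fun y => ∏ k, besselKernel (s k) (y k), by fun_prop⟩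
  have hlim := weyl_continuous p z hz F
  have hint : ∫ y, F y ∂(torusMeasure K) = ∏ k, besselJ0 (s k) := by
    simp only [F, ContinuousMap.coe_mk, torusMeasure]
    rw [integral_fintype_prod_eq_prod (fun k => (besselKernel (s k) : UnitAddCircle → ℂ))]
    simp only [integral_besselKernel]
  rw [hint] at hlim
  refine hlim.congr fun T => ?_
  congr 1
  refine intervalIntegral.integral_congr fun t _ => ?_
  simp only [F, ContinuousMap.coe_mk, torusPath, besselKernel_coe]
  rw [← Complex.exp_sum, ← Finset.mul_sum, ← Complex.ofReal_sum]
  congr 3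
  rw [hx, hx, ← Finset.sum_sub_distrib, Finset.mul_sum]
  refine Finset.sum_congr rfl fun k _ => ?_
  have hid : Real.cos (θ k + (t + h) * z k) - Real.cos (θ k + t * z k) =
      -2 * Real.sin (θ k + t * z k + h * z k / 2) * Real.sin (h * z k / 2) := by
    rw [Real.cos_sub_cos]
    congr 2
    · congr 1; congr 1; ring
    · ring
  have hp : p k + t * z k = (θ k + t * z k + h * z k / 2) + Real.pi / 2 := by
    simp only [p]; ring
  rw [hp, Real.cos_add_pi_div_two, ← mul_sub, hid]
  simp only [s]
  ring
end

section
/- Let K be a positive integer, r_1,…,r_K, θ_1,…,θ_K real numbers, z_1,…,z_K rationally independent real numbers, and define x(τ) = Σ_{k=1}^K r_k cos(θ_k + τ z_k). Let h : ℝ → ℝ be integrable and suppose there is an integrable function g ∈ L¹(ℝ) with h(y) = ∫_ℝ g(w) e^{i y w} dw for all y ∈ ℝ. Then lim_{T→∞} (1/T) ∫_0^T h(x(τ)) dτ = ∫_ℝ g(w) Π_{k=1}^K J₀(w r_k) dw. -/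
open MeasureTheory Filter

/-- The linear flow on the torus. -/
noncomputable def torusFlow {K : ℕ} (θ z : Fin K → ℝ) (τ : ℝ) : UnitAddTorus (Fin K) :=
  fun k => (((θ k + τ * z k) / (2 * Real.pi) : ℝ) : UnitAddCircle)

lemma torusFlow_continuous {K : ℕ} (θ z : Fin K → ℝ) : Continuous (torusFlow θ z) := by
  unfold torusFlow
  refine continuous_pi fun k => ?_
  exact (AddCircle.continuous_mk' 1).comp (by fun_prop)

lemma mFourier_torusFlow {K : ℕ} (θ z : Fin K → ℝ) (m : Fin K → ℤ) (τ : ℝ) :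
    UnitAddTorus.mFourier m (torusFlow θ z τ) =
      Complex.exp (Complex.I * ((∑ k, (m k : ℝ) * θ k : ℝ) : ℂ)) *
        Complex.exp ((Complex.I * ((∑ k, (m k : ℝ) * z k : ℝ) : ℂ)) * τ) := by
  have hpi : (Real.pi : ℂ) ≠ 0 := by exact_mod_cast Real.pi_ne_zero
  rw [← Complex.exp_add]
  simp only [UnitAddTorus.mFourier, ContinuousMap.coe_mk, torusFlow, fourier_coe_apply]
  rw [← Complex.exp_sum]
  congr 1
  push_cast
  simp only [Finset.mul_sum, Finset.sum_mul]
  rw [← Finset.sum_add_distrib]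
  refine Finset.sum_congr rfl fun k _ => ?_
  field_simp

lemma isProb_circle : IsProbabilityMeasure (volume : Measure UnitAddCircle) :=
  ⟨by simp⟩

lemma isProb_torus (K : ℕ) : IsProbabilityMeasure (volume : Measure (UnitAddTorus (Fin K))) := by
  haveI := isProb_circle
  unfold UnitAddTorus
  infer_instance

lemma integral_fourier_ne (n : ℤ) (hn : n ≠ 0) :
    ∫ t : UnitAddCircle, (fourier n t : ℂ) = 0 := by
  have := (orthonormal_iff_ite.mp (orthonormal_fourier (T := (1 : ℝ)))) 0 n
  rw [ContinuousMap.inner_toLp, if_neg hn.symm, AddCircle.integral_haarAddCircle] at this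
  simpa using this

lemma integral_mFourier_ne {K : ℕ} (m : Fin K → ℤ) (hm : m ≠ 0) :
    ∫ t, UnitAddTorus.mFourier m t = 0 := by
  rw [UnitAddTorus.mFourier, ContinuousMap.coe_mk, integral_fintype_prod_volume_eq_prod]
  obtain ⟨i, hi⟩ := Function.ne_iff.mp hm
  exact Finset.prod_eq_zero (Finset.mem_univ i) (integral_fourier_ne _ hi)

lemma timeAvg_mFourier {K : ℕ} (θ z : Fin K → ℝ) (hz : RationallyIndependent z)
    (m : Fin K → ℤ) :
    Tendsto (fun T : ℝ => (T : ℂ)⁻¹ * ∫ τ in (0 : ℝ)..T,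
      UnitAddTorus.mFourier m (torusFlow θ z τ)) atTop
      (nhds (∫ t, UnitAddTorus.mFourier m t)) := by
  haveI := isProb_torus K
  by_cases hm : m = 0
  · subst hm
    simp only [UnitAddTorus.mFourier_zero, ContinuousMap.one_apply]
    apply tendsto_const_nhds.congr'
    filter_upwards [eventually_gt_atTop 0] with T hT
    have : (T : ℂ) ≠ 0 := by exact_mod_cast hT.ne'
    simp [this]
  · rw [integral_mFourier_ne m hm]
    have hs : (∑ k, (m k : ℝ) * z k) ≠ 0 := fun h0 => hm (funext (hz m h0))
    set s : ℝ := ∑ k, (m k : ℝ) * z k with hsdef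
    have hc : Complex.I * (s : ℂ) ≠ 0 :=
      mul_ne_zero Complex.I_ne_zero (by exact_mod_cast hs)
    simp only [mFourier_torusFlow, intervalIntegral.integral_const_mul, ← hsdef,
      integral_exp_mul_complex hc]
    have h1 : Tendsto (fun T : ℝ => T⁻¹ * (2 / |s|)) atTop (nhds 0) := by
      simpa using tendsto_inv_atTop_zero.mul_const (2 / |s|)
    refine squeeze_zero_norm' ?_ h1
    filter_upwards [eventually_gt_atTop 0] with T hT
    rw [norm_mul, norm_mul, norm_div]
    have e1 : ‖Complex.exp (Complex.I * ((∑ k, (m k : ℝ) * θ k : ℝ) : ℂ))‖ = 1 := by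
      rw [mul_comm, Complex.norm_exp_ofReal_mul_I]
    have e2 : ‖Complex.exp (Complex.I * (s : ℂ) * (T : ℂ))‖ = 1 := by
      have : Complex.I * (s : ℂ) * (T : ℂ) = ((s * T : ℝ) : ℂ) * Complex.I := by
        push_cast; ring
      rw [this, Complex.norm_exp_ofReal_mul_I]
    have e3 : ‖Complex.exp (Complex.I * (s : ℂ) * (T : ℂ)) -
        Complex.exp (Complex.I * (s : ℂ) * ((0 : ℝ) : ℂ))‖ ≤ 2 := by
      refine (norm_sub_le _ _).trans ?_
      rw [e2]; simp; norm_num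
    rw [e1, one_mul, norm_inv, Complex.norm_real, Real.norm_of_nonneg hT.le, norm_mul,
      Complex.norm_I, one_mul, Complex.norm_real, Real.norm_eq_abs]
    gcongr

lemma timeAvg_sub_le {K : ℕ} (θ z : Fin K → ℝ) (f p : C(UnitAddTorus (Fin K), ℂ))
    (T : ℝ) :
    ‖(T : ℂ)⁻¹ * (∫ τ in (0 : ℝ)..T, f (torusFlow θ z τ)) -
      (T : ℂ)⁻¹ * ∫ τ in (0 : ℝ)..T, p (torusFlow θ z τ)‖ ≤ ‖f - p‖ := by
  have hf : Continuous fun τ => f (torusFlow θ z τ) := f.continuous.comp (torusFlow_continuous θ z)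
  have hp : Continuous fun τ => p (torusFlow θ z τ) := p.continuous.comp (torusFlow_continuous θ z)
  rw [← mul_sub, ← intervalIntegral.integral_sub (hf.intervalIntegrable _ _)
    (hp.intervalIntegrable _ _), norm_mul, norm_inv, Complex.norm_real]
  have := intervalIntegral.norm_integral_le_of_norm_le_const (a := 0) (b := T)
    (f := fun τ => f (torusFlow θ z τ) - p (torusFlow θ z τ)) (C := ‖f - p‖)
    (fun τ _ => (f - p).norm_coe_le_norm (torusFlow θ z τ))
  rw [sub_zero] at this
  by_cases hT : T = 0
  · simp [hT]
  · have hT' : 0 < |T| := abs_pos.mpr hT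
    rw [Real.norm_eq_abs, inv_mul_le_iff₀ hT']
    linarith

lemma timeAvg_continuous {K : ℕ} (θ z : Fin K → ℝ) (hz : RationallyIndependent z)
    (f : C(UnitAddTorus (Fin K), ℂ)) :
    Tendsto (fun T : ℝ => (T : ℂ)⁻¹ * ∫ τ in (0 : ℝ)..T, f (torusFlow θ z τ)) atTop
      (nhds (∫ t, f t)) := by
  haveI := isProb_torus K
  have hint : ∀ p : C(UnitAddTorus (Fin K), ℂ), Integrable (fun t => p t) volume := fun p =>
    p.continuous.integrable_of_hasCompactSupport (HasCompactSupport.of_compactSpace _)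
  have hII : ∀ (p : C(UnitAddTorus (Fin K), ℂ)) (T : ℝ),
      IntervalIntegrable (fun τ => p (torusFlow θ z τ)) volume 0 T := fun p T =>
    (p.continuous.comp (torusFlow_continuous θ z)).intervalIntegrable _ _
  have hspan : ∀ p ∈ Submodule.span ℂ (Set.range (UnitAddTorus.mFourier (d := Fin K))),
      Tendsto (fun T : ℝ => (T : ℂ)⁻¹ * ∫ τ in (0 : ℝ)..T, p (torusFlow θ z τ)) atTop
      (nhds (∫ t, p t)) := by
    intro p hp
    induction hp using Submodule.span_induction with
    | mem p hp =>
      obtain ⟨m, rfl⟩ := hp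
      exact timeAvg_mFourier θ z hz m
    | zero => simp
    | add p q _ _ hp hq =>
      simp only [ContinuousMap.add_apply]
      rw [integral_add (hint p) (hint q)]
      refine (hp.add hq).congr fun T => ?_
      rw [intervalIntegral.integral_add (hII p T) (hII q T), mul_add]
    | smul c p _ hp =>
      simp only [ContinuousMap.smul_apply, smul_eq_mul]
      rw [integral_const_mul]
      refine (hp.const_mul c).congr fun T => ?_
      rw [intervalIntegral.integral_const_mul]
      ring
  have hmem : f ∈ closure
      ((Submodule.span ℂ (Set.range (UnitAddTorus.mFourier (d := Fin K))) :
        Submodule ℂ C(UnitAddTorus (Fin K), ℂ)) : Set C(UnitAddTorus (Fin K), ℂ)) := by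
    rw [← Submodule.topologicalClosure_coe, UnitAddTorus.span_mFourier_closure_eq_top]
    trivial
  rw [Metric.tendsto_nhds]
  intro ε hε
  obtain ⟨p, hp, hd⟩ := Metric.mem_closure_iff.mp hmem (ε / 3) (by positivity)
  filter_upwards [Metric.tendsto_nhds.mp (hspan p hp) (ε / 3) (by positivity)] with T hT
  have h1 := timeAvg_sub_le θ z f p T
  have h2 : ‖(∫ t, p t) - ∫ t, f t‖ ≤ ‖p - f‖ := by
    rw [← integral_sub (hint p) (hint f)]
    refine (norm_integral_le_of_norm_le_const (C := ‖p - f‖)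
      (Eventually.of_forall fun t => (p - f).norm_coe_le_norm t)).trans ?_
    simp
  rw [dist_eq_norm] at hd
  rw [← dist_eq_norm] at h1 h2
  rw [norm_sub_rev] at h2
  have := dist_triangle4 ((T : ℂ)⁻¹ * (∫ τ in (0 : ℝ)..T, f (torusFlow θ z τ)))
    ((T : ℂ)⁻¹ * ∫ τ in (0 : ℝ)..T, p (torusFlow θ z τ)) (∫ t, p t) (∫ t, f t)
  linarith

/-- The observable `exp(i s cos(2π t))` on the circle. -/
noncomputable def circObs (s : ℝ) (t : UnitAddCircle) : ℂ :=
  Complex.exp (Complex.I * ((s * (fourier 1 t : ℂ).re : ℝ) : ℂ))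

lemma circObs_continuous (s : ℝ) : Continuous (circObs s) := by
  unfold circObs
  fun_prop

lemma circObs_coe (s u : ℝ) : circObs s ((u / (2 * Real.pi) : ℝ) : UnitAddCircle) =
    Complex.exp (Complex.I * ((s * Real.cos u : ℝ) : ℂ)) := by
  unfold circObs
  rw [fourier_coe_apply]
  have hpi : (Real.pi : ℂ) ≠ 0 := by exact_mod_cast Real.pi_ne_zero
  have : (2 * Real.pi * Complex.I * ((1 : ℤ) : ℂ) * ((u / (2 * Real.pi) : ℝ) : ℂ) / ((1 : ℝ) : ℂ))
      = (u : ℂ) * Complex.I := by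
    push_cast; field_simp
  rw [this, Complex.exp_ofReal_mul_I_re]

lemma integral_circObs (s : ℝ) : ∫ t, circObs s t = besselJ0 s := by
  unfold besselJ0
  rw [← UnitAddCircle.intervalIntegral_preimage (-1 / 2)]
  simp only [← circObs_coe]
  rw [intervalIntegral.integral_comp_div
    (f := fun v : ℝ => circObs s (v : UnitAddCircle)) (by positivity)]
  have hpi := Real.pi_ne_zero
  have e1 : -Real.pi / (2 * Real.pi) = -1 / 2 := by field_simp
  have e2 : Real.pi / (2 * Real.pi) = -1 / 2 + 1 := by field_simp; norm_num
  rw [e1, e2, Complex.real_smul, ← mul_assoc, inv_mul_cancel₀, one_mul]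
  exact_mod_cast (by positivity : (2 * Real.pi) ≠ 0)

lemma timeAvg_exp {K : ℕ} (r θ z : Fin K → ℝ) (hz : RationallyIndependent z) (w : ℝ) :
    Tendsto (fun T : ℝ => (T : ℂ)⁻¹ * ∫ τ in (0 : ℝ)..T,
      Complex.exp (Complex.I * (((∑ k, r k * Real.cos (θ k + τ * z k)) * w : ℝ) : ℂ))) atTop
      (nhds (∏ k, besselJ0 (w * r k))) := by
  have hc : Continuous fun t : UnitAddTorus (Fin K) => ∏ k, circObs (w * r k) (t k) :=
    continuous_finsetProd _ fun k _ => (circObs_continuous _).comp (continuous_apply k)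
  have := timeAvg_continuous θ z hz ⟨_, hc⟩
  simp only [ContinuousMap.coe_mk] at this
  rw [integral_fintype_prod_volume_eq_prod] at this
  simp only [integral_circObs] at this
  refine this.congr fun T => ?_
  congr 1
  refine intervalIntegral.integral_congr fun τ _ => ?_
  simp only [torusFlow, circObs_coe]
  rw [← Complex.exp_sum, ← Finset.mul_sum]
  congr 2
  rw [← Complex.ofReal_sum, Finset.sum_mul]
  congr 1
  exact Finset.sum_congr rfl fun k _ => by ring

theorem timeAverage_L1_observable_tendsto
    (K : ℕ) (hK : 0 < K) (r θ z : Fin K → ℝ) (hz : RationallyIndependent z)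
    (x : ℝ → ℝ) (hx : ∀ τ, x τ = ∑ k, r k * Real.cos (θ k + τ * z k))
    (h : ℝ → ℝ) (hint : Integrable h)
    (g : ℝ → ℂ) (hg : Integrable g)
    (hfour : ∀ y : ℝ, (h y : ℂ) = ∫ w : ℝ, g w * Complex.exp (Complex.I * ((y * w : ℝ) : ℂ))) :
    Tendsto
      (fun T : ℝ => ((T : ℂ))⁻¹ * ∫ τ in (0 : ℝ)..T, (h (x τ) : ℂ))
      atTop
      (nhds (∫ w : ℝ, g w * ∏ k, besselJ0 (w * r k))) := by
  have hxc : Continuous x := by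
    rw [funext hx]; fun_prop
  have hE : Continuous fun q : ℝ × ℝ => Complex.exp (Complex.I * ((x q.1 * q.2 : ℝ) : ℂ)) := by
    fun_prop
  have hn : ∀ a : ℝ, ‖Complex.exp (Complex.I * (a : ℂ))‖ = 1 := fun a => by
    rw [mul_comm, Complex.norm_exp_ofReal_mul_I]
  have hA : ∀ w : ℝ, Tendsto (fun T : ℝ => (T : ℂ)⁻¹ * ∫ τ in (0 : ℝ)..T,
      Complex.exp (Complex.I * ((x τ * w : ℝ) : ℂ))) atTop (nhds (∏ k, besselJ0 (w * r k))) := by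
    intro w
    simp only [hx]
    exact timeAvg_exp r θ z hz w
  have hcont : ∀ T : ℝ, Continuous fun w : ℝ => ∫ τ in (0 : ℝ)..T,
      Complex.exp (Complex.I * ((x τ * w : ℝ) : ℂ)) := by
    intro T
    refine intervalIntegral.continuous_parametric_intervalIntegral_of_continuous'
      (f := fun w τ => Complex.exp (Complex.I * ((x τ * w : ℝ) : ℂ))) ?_ _ _
    simp only [Function.uncurry_def]
    exact hE.comp continuous_swap
  have hD : Tendsto (fun T : ℝ => ∫ w : ℝ, g w * ((T : ℂ)⁻¹ * ∫ τ in (0 : ℝ)..T,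
      Complex.exp (Complex.I * ((x τ * w : ℝ) : ℂ)))) atTop
      (nhds (∫ w : ℝ, g w * ∏ k, besselJ0 (w * r k))) := by
    refine tendsto_integral_filter_of_dominated_convergence (fun w => ‖g w‖) ?_ ?_ hg.norm ?_
    · exact Eventually.of_forall fun T =>
        hg.aestronglyMeasurable.mul ((hcont T).const_mul _).aestronglyMeasurable
    · filter_upwards [eventually_gt_atTop 0] with T hT
      refine Eventually.of_forall fun w => ?_
      have := intervalIntegral.norm_integral_le_of_norm_le_const (a := 0) (b := T)
        (f := fun τ => Complex.exp (Complex.I * ((x τ * w : ℝ) : ℂ))) (C := 1)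
        (fun τ _ => (hn _).le)
      rw [sub_zero, abs_of_pos hT, one_mul] at this
      rw [norm_mul, norm_mul, norm_inv, Complex.norm_real, Real.norm_of_nonneg hT.le]
      refine mul_le_of_le_one_right (norm_nonneg _) ?_
      rw [inv_mul_le_iff₀ hT]
      linarith
    · exact Eventually.of_forall fun w => (hA w).const_mul _
  refine hD.congr' ?_
  filter_upwards [eventually_gt_atTop 0] with T hT
  simp only [hfour]
  have hprod : Integrable (fun q : ℝ × ℝ => g q.2 * Complex.exp (Complex.I * ((x q.1 * q.2 : ℝ) : ℂ)))
      ((volume.restrict (Set.Ioc 0 T)).prod volume) := by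
    have h0 : Integrable (fun q : ℝ × ℝ => (1 : ℂ) * g q.2)
        ((volume.restrict (Set.Ioc 0 T)).prod volume) :=
      Integrable.mul_prod (f := fun _ : ℝ => (1 : ℂ)) (integrable_const _) hg
    simp only [one_mul] at h0
    refine h0.mono (h0.aestronglyMeasurable.mul hE.aestronglyMeasurable) ?_
    exact Eventually.of_forall fun q => by rw [norm_mul, hn, mul_one]
  rw [intervalIntegral.integral_of_le hT.le, integral_integral_swap hprod,
    ← integral_const_mul]
  refine integral_congr_ae (Eventually.of_forall fun w => ?_)
  simp only
  rw [integral_const_mul, intervalIntegral.integral_of_le hT.le]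
  ring
end
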